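/- arXiv:2506.22130 — 2 statements merged into one kernel-verified Lean document; each statement's English description precedes it below -/
import Mathlib

section
/- Let f : G₁ → G₂ be a map of discrete graphs such that (1) for every vertex V of G₂ the inverse image f⁻¹(V) ⊆ F(G₁) is a legless tree (a connected legless subgraph of genus 0), and (2) for every edge or leg of G₂ the inverse image under f consists of a single edge or leg. Then there is a natural bijective map of graphs G₁/f⁻¹(V(G₂)) → G₂, where G₁/K denotes the graph obtained from G₁ by contracting every edge of each connected component of the legless subgraph K, each component being replaced by a single new vertex. -/
open scoped Classical

noncomputable section
/-! ### Discrete graphs and discrete admissible covers -/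

/-- A discrete graph: a finite set of flags with a root map and an involution. -/
structure DiscreteGraph : Type 1 where
  F : Type
  fintypeF : Fintype F
  r : F → F
  ι : F → F
  invol : ∀ x, ι (ι x) = x
  ir : ∀ x, ι (r x) = r x
  r_idem : ∀ x, r (r x) = r x

attribute [instance] DiscreteGraph.fintypeF

namespace DiscreteGraph

variable (G : DiscreteGraph)

/-- Vertices are the elements of the image of the root map. -/
def IsVertex (x : G.F) : Prop := x ∈ Set.range G.r

/-- `x` is a leg: a non-vertex flag fixed by the involution. -/
def IsLeg (x : G.F) : Prop := ¬ G.IsVertex x ∧ G.ι x = x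

/-- `x` is one of the two halves of an edge. -/
def IsEdgeHalf (x : G.F) : Prop := ¬ G.IsVertex x ∧ G.ι x ≠ x

/-- The valency of a vertex: `# r⁻¹(V) - 1`. -/
def valency (v : G.F) : ℤ := ((Finset.univ.filter fun x => G.r x = v).card : ℤ) - 1

/-- The number of legs of the graph. -/
def numLegs : ℕ := (Finset.univ.filter fun x => G.IsLeg x).card

/-- The number of halves of edges of the graph (twice the number of edges). -/
def numEdgeHalves : ℕ := (Finset.univ.filter fun x => G.IsEdgeHalf x).card

/-- The number of vertices of the graph. -/
def numVertices : ℕ := (Finset.univ.filter fun x => G.IsVertex x).card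

/-- The genus `#E - #V + 1` of a connected discrete graph. -/
def genusZ : ℤ := ((G.numEdgeHalves / 2 : ℕ) : ℤ) - (G.numVertices : ℤ) + 1

/-- The adjacency relation generating the connectivity of the graph. -/
def adj : G.F → G.F → Prop := fun x y => y = G.r x ∨ y = G.ι x

/-- A discrete graph is connected when any two flags are related by a chain of
adjacencies. -/
def Connected : Prop := ∀ x y : G.F, Relation.EqvGen G.adj x y

end DiscreteGraph

/-- A map of discrete graphs: a map of flags commuting with the root maps and
the involutions. -/
structure GraphMap (G₁ G₂ : DiscreteGraph) where
  toFun : G₁.F → G₂.F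
  comm_r : ∀ x, G₂.r (toFun x) = toFun (G₁.r x)
  comm_ι : ∀ x, G₂.ι (toFun x) = toFun (G₁.ι x)

/-- A discrete admissible cover: a surjective, non-contracting map of graphs with
a degree assignment satisfying the local balancing condition and the vanishing of
all Riemann–Hurwitz numbers. -/
structure DiscAdmCover (G₁ G₂ : DiscreteGraph) extends GraphMap G₁ G₂ where
  surjective : Function.Surjective toFun
  noncontracting : ∀ x, G₂.IsVertex (toFun x) → G₁.IsVertex x
  d : G₁.F → ℕ
  d_invol : ∀ x, d (G₁.ι x) = d x
  balanced : ∀ V, G₁.IsVertex V → ∀ H', G₂.r H' = toFun V → H' ≠ toFun V →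
      (d V : ℤ) = ∑ h ∈ Finset.univ.filter (fun h => toFun h = H' ∧ G₁.r h = V), (d h : ℤ)
  rh_vanish : ∀ V, G₁.IsVertex V →
      G₁.valency V - 2 = (d V : ℤ) * (G₂.valency (toFun V) - 2)

namespace DiscAdmCover

variable {G₁ G₂ : DiscreteGraph} (π : DiscAdmCover G₁ G₂)

/-- The degree of the cover, computed at a vertex `A` of the target. -/
def degAt (A : G₂.F) : ℤ :=
  ∑ V ∈ Finset.univ.filter (fun V => π.toFun V = A), (π.d V : ℤ)

/-- The Riemann–Hurwitz number of the cover at a vertex of the source. -/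
def rhNum (V : G₁.F) : ℤ :=
  G₁.valency V - 2 - (π.d V : ℤ) * (G₂.valency (π.toFun V) - 2)

end DiscAdmCover
/-! ### Contraction of subgraphs -/

namespace DiscreteGraph

variable (G : DiscreteGraph)

/-- The relation generating the contraction of the subgraph with set of flags `K`:
every flag of `K` is identified with its root and with its involution. -/
def contractRel (K : Set G.F) : G.F → G.F → Prop :=
  fun x y => x ∈ K ∧ (y = G.r x ∨ y = G.ι x)

/-- The contraction `G/K` of the (closed) subgraph with set of flags `K`: every
connected component of `K` is collapsed to a single new vertex. -/
def Contract (K : Set G.F) (hK : ∀ x ∈ K, G.r x ∈ K ∧ G.ι x ∈ K) : DiscreteGraph where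
  F := Quot (G.contractRel K)
  fintypeF := by
    have : Finite (Quot (G.contractRel K)) :=
      Finite.of_surjective (Quot.mk _) fun q => Quot.exists_rep q
    exact Fintype.ofFinite _
  r := Quot.lift (fun x => Quot.mk _ (G.r x)) (by
    intro x y hxy
    obtain ⟨hxK, hy⟩ := hxy
    show Quot.mk _ (G.r x) = Quot.mk _ (G.r y)
    rcases hy with rfl | rfl
    · rw [G.r_idem]
    · have h1 : Quot.mk (G.contractRel K) x = Quot.mk _ (G.r x) :=
        Quot.sound ⟨hxK, Or.inl rfl⟩
      have h2 : Quot.mk (G.contractRel K) x = Quot.mk _ (G.ι x) :=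
        Quot.sound ⟨hxK, Or.inr rfl⟩
      have h3 : Quot.mk (G.contractRel K) (G.ι x) = Quot.mk _ (G.r (G.ι x)) :=
        Quot.sound ⟨(hK x hxK).2, Or.inl rfl⟩
      rw [← h1, h2, h3])
  ι := Quot.lift (fun x => Quot.mk _ (G.ι x)) (by
    intro x y hxy
    obtain ⟨hxK, hy⟩ := hxy
    show Quot.mk _ (G.ι x) = Quot.mk _ (G.ι y)
    rcases hy with rfl | rfl
    · have h1 : Quot.mk (G.contractRel K) (G.ι x) = Quot.mk _ (G.ι (G.ι x)) :=
        Quot.sound ⟨(hK x hxK).2, Or.inr rfl⟩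
      have h2 : Quot.mk (G.contractRel K) x = Quot.mk _ (G.r x) :=
        Quot.sound ⟨hxK, Or.inl rfl⟩
      rw [G.ir, h1, G.invol, h2]
    · rw [G.invol]
      exact (Quot.sound ⟨hxK, Or.inr rfl⟩).symm)
  invol := by
    intro q
    induction q using Quot.ind with
    | _ x =>
      show Quot.mk _ (G.ι (G.ι x)) = Quot.mk _ x
      rw [G.invol]
  ir := by
    intro q
    induction q using Quot.ind with
    | _ x =>
      show Quot.mk _ (G.ι (G.r x)) = Quot.mk _ (G.r x)
      rw [G.ir]
  r_idem := by
    intro q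
    induction q using Quot.ind with
    | _ x =>
      show Quot.mk _ (G.r (G.r x)) = Quot.mk _ (G.r x)
      rw [G.r_idem]

/-- The adjacency relation within a subgraph. -/
def subAdj (S : Set G.F) : G.F → G.F → Prop :=
  fun x y => x ∈ S ∧ y ∈ S ∧ (y = G.r x ∨ y = G.ι x)

/-- The set of flags `S` is a legless tree: a nonempty subgraph without legs,
connected and of genus `0` (`#V = #E + 1`). -/
def IsLeglessTree (S : Set G.F) : Prop :=
  S.Nonempty ∧
  (∀ x ∈ S, G.r x ∈ S ∧ G.ι x ∈ S) ∧
  (∀ x ∈ S, G.ι x = x → G.IsVertex x) ∧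
  (∀ x ∈ S, ∀ y ∈ S, Relation.EqvGen (G.subAdj S) x y) ∧
  2 * (Finset.univ.filter fun x => x ∈ S ∧ G.IsVertex x).card
    = (Finset.univ.filter fun x => x ∈ S ∧ G.ι x ≠ x).card + 2

end DiscreteGraph

namespace DiscreteGraph

variable {G : DiscreteGraph}

theorem IsVertex.r_eq {v : G.F} (hv : G.IsVertex v) : G.r v = v := by
  obtain ⟨x, rfl⟩ := hv
  exact G.r_idem x

theorem IsVertex.ι_eq {v : G.F} (hv : G.IsVertex v) : G.ι v = v := by
  obtain ⟨x, rfl⟩ := hv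
  exact G.ir x

/-- Flags connected within a subset of `K` are identified in the contraction of `K`. -/
theorem quot_mk_eq_of_eqvGen_subAdj {S K : Set G.F} (hSK : S ⊆ K) {x y : G.F}
    (h : Relation.EqvGen (G.subAdj S) x y) :
    Quot.mk (G.contractRel K) x = Quot.mk (G.contractRel K) y :=
  Quot.eqvGen_sound (h.mono fun _ _ hab => ⟨hSK hab.1, hab.2.2⟩)

end DiscreteGraph

namespace GraphMap

variable {G₁ G₂ : DiscreteGraph} (f : GraphMap G₁ G₂)

theorem apply_eq_of_contractRel {x y : G₁.F}
    (h : G₁.contractRel {x | G₂.IsVertex (f.toFun x)} x y) : f.toFun x = f.toFun y := by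
  obtain ⟨hx, rfl | rfl⟩ := h
  · rw [← f.comm_r, hx.r_eq]
  · rw [← f.comm_ι, hx.ι_eq]

/-- A map of graphs factors through the contraction of the inverse image of the vertices. -/
def contractLift
    (hK : ∀ x ∈ {x | G₂.IsVertex (f.toFun x)},
      G₁.r x ∈ {x | G₂.IsVertex (f.toFun x)} ∧ G₁.ι x ∈ {x | G₂.IsVertex (f.toFun x)}) :
    GraphMap (G₁.Contract {x | G₂.IsVertex (f.toFun x)} hK) G₂ where
  toFun := Quot.lift f.toFun fun _ _ h => f.apply_eq_of_contractRel h
  comm_r := by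
    rintro ⟨x⟩
    exact f.comm_r x
  comm_ι := by
    rintro ⟨x⟩
    exact f.comm_ι x

end GraphMap

/-- if every vertex fiber of a map of graphs `f : G₁ → G₂` is a legless
tree and every edge or leg of `G₂` has a single edge or leg as inverse image, then
the contraction `G₁ / f⁻¹(V(G₂))` is naturally bijective onto `G₂`. -/
theorem contract_fibers_bijective (G₁ G₂ : DiscreteGraph) (f : GraphMap G₁ G₂)
    (h1 : ∀ v, G₂.IsVertex v → G₁.IsLeglessTree {x | f.toFun x = v})
    (h2 : ∀ h, ¬ G₂.IsVertex h → ∃! x, f.toFun x = h)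
    (hK : ∀ x ∈ {x | G₂.IsVertex (f.toFun x)},
      G₁.r x ∈ {x | G₂.IsVertex (f.toFun x)} ∧ G₁.ι x ∈ {x | G₂.IsVertex (f.toFun x)}) :
    ∃ φ : GraphMap (G₁.Contract {x | G₂.IsVertex (f.toFun x)} hK) G₂,
      Function.Bijective φ.toFun ∧ ∀ x : G₁.F, φ.toFun (Quot.mk _ x) = f.toFun x := by
  refine ⟨f.contractLift hK, ⟨?_, ?_⟩, fun _ => rfl⟩
  · rintro ⟨x⟩ ⟨y⟩ (hxy : f.toFun x = f.toFun y)
    by_cases hy : G₂.IsVertex (f.toFun y)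
    · obtain ⟨-, -, -, hconn, -⟩ := h1 _ hy
      refine DiscreteGraph.quot_mk_eq_of_eqvGen_subAdj ?_ (hconn x hxy y rfl)
      rintro z (hz : f.toFun z = f.toFun y)
      show G₂.IsVertex (f.toFun z)
      rwa [hz]
    · exact congrArg (Quot.mk _) ((h2 _ hy).unique hxy rfl)
  · intro w
    by_cases hw : G₂.IsVertex w
    · obtain ⟨x, hx⟩ := (h1 w hw).1
      exact ⟨Quot.mk _ x, hx⟩
    · obtain ⟨x, hx⟩ := (h2 w hw).exists
      exact ⟨Quot.mk _ x, hx⟩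
end
end

section
/- Let π : Γ → Δ be a tropical admissible cover. The pullback morphism π* : Div(Δ) → Div(Γ) maps effective divisors to effective divisors and preserves linear equivalence; moreover, for every D ∈ Div(Δ), deg(π*D) = deg(π) · deg(D). -/
open scoped Classical

noncomputable section

/-! ## Combinatorial models of metric graphs and their topological realizations -/

/-- A combinatorial model of a metric graph: a finite multigraph with positive
edge lengths. -/
structure CombGraph : Type 1 where
  V : Type
  E : Type
  fintypeV : Fintype V
  fintypeE : Fintype E
  src : E → V
  tgt : E → V
  len : E → ℝ
  len_pos : ∀ e, 0 < len e

attribute [instance] CombGraph.fintypeV CombGraph.fintypeE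

namespace CombGraph

variable (G : CombGraph)

instance : TopologicalSpace G.V := ⊥
instance : TopologicalSpace G.E := ⊥

/-- The disjoint union of the vertices and of the edges seen as real intervals,
before gluing. -/
def Pre : Type := G.V ⊕ (G.E × ℝ)

instance : TopologicalSpace G.Pre := inferInstanceAs (TopologicalSpace (G.V ⊕ (G.E × ℝ)))

/-- The predicate selecting legitimate points: a point of an edge `e` must have its
coordinate in `[0, len e]`. -/
def Ok : G.Pre → Prop
  | Sum.inl _ => True
  | Sum.inr p => 0 ≤ p.2 ∧ p.2 ≤ G.len p.1

/-- Points of the model before gluing. -/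
def PreR : Type := {p : G.Pre // G.Ok p}

instance : TopologicalSpace G.PreR := inferInstanceAs (TopologicalSpace {p : G.Pre // G.Ok p})

/-- The gluing relation: the endpoints of each edge are glued to the corresponding
vertices. -/
inductive Glue : G.PreR → G.PreR → Prop
  | srcGlue (e : G.E) :
      Glue ⟨Sum.inl (G.src e), trivial⟩ ⟨Sum.inr (e, 0), ⟨le_refl 0, (G.len_pos e).le⟩⟩
  | tgtGlue (e : G.E) :
      Glue ⟨Sum.inl (G.tgt e), trivial⟩ ⟨Sum.inr (e, G.len e), ⟨(G.len_pos e).le, le_refl _⟩⟩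

/-- The topological realization of the combinatorial model: the underlying
topological space of the associated metric graph. -/
def Space : Type := Quot G.Glue

instance : TopologicalSpace G.Space := inferInstanceAs (TopologicalSpace (Quot G.Glue))

/-- The point of the realization corresponding to a vertex. -/
def vertexPt (v : G.V) : G.Space := Quot.mk _ ⟨Sum.inl v, trivial⟩

/-- Clamping of a real coordinate into `[0, len e]`. -/
def clamp (e : G.E) (t : ℝ) : ℝ := max 0 (min t (G.len e))

/-- The point of the realization lying on the edge `e` at coordinate `t`
(the coordinate is clamped into `[0, len e]`). -/
def edgePt (e : G.E) (t : ℝ) : G.Space :=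
  Quot.mk _ ⟨Sum.inr (e, G.clamp e t),
    ⟨le_max_left 0 _, max_le (G.len_pos e).le (min_le_right _ _)⟩⟩

/-- The genus (first Betti number) of the (connected) metric graph. -/
def genus : ℤ := (Fintype.card G.E : ℤ) - (Fintype.card G.V : ℤ) + 1

/-! ### Outgoing directions, valence -/

/-- `d = (e, b)` is an outgoing unit tangent direction at the point `x`:
if `b = true` it points in the direction of increasing coordinate on `e`, if
`b = false` in the direction of decreasing coordinate. -/
def IsDir (x : G.Space) (d : G.E × Bool) : Prop :=
  if d.2 then ∃ t, 0 ≤ t ∧ t < G.len d.1 ∧ x = G.edgePt d.1 t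
  else ∃ t, 0 < t ∧ t ≤ G.len d.1 ∧ x = G.edgePt d.1 t

/-- The (finite) set of outgoing directions at a point. -/
def dirSet (x : G.Space) : Finset (G.E × Bool) :=
  Finset.univ.filter fun d => G.IsDir x d

/-- The valence of a point of the realization: the number of outgoing
directions at that point. -/
def valence (x : G.Space) : ℕ := (G.dirSet x).card

/-- The coordinate on the edge `d.1` of a point `x` admitting `d` as an outgoing
direction. -/
def dirCoord (x : G.Space) (d : G.E × Bool) : ℝ :=
  if d.2 then
    (if h : ∃ t, 0 ≤ t ∧ t < G.len d.1 ∧ x = G.edgePt d.1 t then h.choose else 0)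
  else
    (if h : ∃ t, 0 < t ∧ t ≤ G.len d.1 ∧ x = G.edgePt d.1 t then h.choose else 0)

/-- The point at distance `u` from `x` in the outgoing direction `d`. -/
def dirPt (x : G.Space) (d : G.E × Bool) (u : ℝ) : G.Space :=
  G.edgePt d.1 (G.dirCoord x d + (if d.2 then u else -u))

end CombGraph

/-! ### Rational functions and divisors -/

/-- A function `g : [0, L] → ℝ` is piecewise integral affine if there is a finite
subdivision of `[0, L]` on whose pieces `g` is affine with integral slope. -/
def PWIntAffine (g : ℝ → ℝ) (L : ℝ) : Prop :=
  ∃ (n : ℕ) (t : ℕ → ℝ) (m : ℕ → ℤ) (b : ℕ → ℝ),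
    t 0 = 0 ∧ t n = L ∧ (∀ i, i < n → t i < t (i + 1)) ∧
    (∀ i, i < n → ∀ u, t i ≤ u → u ≤ t (i + 1) → g u = (m i : ℝ) * u + b i)

/-- A rational function on the metric graph realizing `G`: a continuous function
which is piecewise integral affine on every edge. -/
structure RatFn (G : CombGraph) where
  toFun : G.Space → ℝ
  continuous : Continuous toFun
  piecewise : ∀ e : G.E, PWIntAffine (fun t => toFun (G.edgePt e t)) (G.len e)

namespace CombGraph

variable (G : CombGraph)

/-- The right-hand slope of a rational function on the edge `e` at coordinate `t`. -/
def rightSlope (f : RatFn G) (e : G.E) (t : ℝ) : ℝ :=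
  derivWithin (fun u => f.toFun (G.edgePt e u)) (Set.Ici t) t

/-- The left-hand slope of a rational function on the edge `e` at coordinate `t`. -/
def leftSlope (f : RatFn G) (e : G.E) (t : ℝ) : ℝ :=
  derivWithin (fun u => f.toFun (G.edgePt e u)) (Set.Iic t) t

/-- The order of a rational function at a point: the sum of its outgoing slopes. -/
def ordAt (f : RatFn G) (x : G.Space) : ℝ :=
  if h : ∃ v : G.V, x = G.vertexPt v then
    ∑ e : G.E,
      ((if G.src e = h.choose then G.rightSlope f e 0 else 0)
        + (if G.tgt e = h.choose then -(G.leftSlope f e (G.len e)) else 0))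
  else if h2 : ∃ p : G.E × ℝ, 0 < p.2 ∧ p.2 < G.len p.1 ∧ x = G.edgePt p.1 p.2 then
    G.rightSlope f h2.choose.1 h2.choose.2 - G.leftSlope f h2.choose.1 h2.choose.2
  else 0

/-- The group of divisors of the metric graph: the free abelian group on the
points of the realization. -/
abbrev Div (G : CombGraph) : Type := G.Space →₀ ℤ

/-- The degree of a divisor. -/
def degDiv (D : Div G) : ℤ := D.sum fun _ n => n

/-- A divisor is effective if all of its coefficients are nonnegative. -/
def Effective (D : Div G) : Prop := ∀ x, 0 ≤ D x

/-- `D` is the principal divisor associated to the rational function `f`. -/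
def IsPrincipal (D : Div G) (f : RatFn G) : Prop := ∀ x, (D x : ℝ) = G.ordAt f x

/-- Two divisors are linearly equivalent if their difference is principal. -/
def LinEquiv (D D' : Div G) : Prop := ∃ f : RatFn G, G.IsPrincipal (D - D') f

/-- The Baker–Norine rank of a divisor: the largest integer `k` such that for every
effective divisor `E` of degree `k` the linear system `|D - E|` is nonempty.  (For
negative `k` the condition is vacuous, so the supremum is `-1` exactly when
`|D|` is empty.) -/
def Rk (D : Div G) : ℤ :=
  sSup {k : ℤ | ∀ E : Div G, G.Effective E → G.degDiv E = k →
    ∃ E' : Div G, G.Effective E' ∧ G.LinEquiv (D - E) E'}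

/-- A point of a metric graph is a Weierstrass point if `rk(g·[x]) ≥ 1`. -/
def IsWeierstrass (x : G.Space) : Prop :=
  1 ≤ G.Rk (G.genus • Finsupp.single x 1)

/-- The canonical divisor of a metric graph. -/
def canonical : Div G :=
  ∑ v : G.V, ((G.valence (G.vertexPt v) : ℤ) - 2) • Finsupp.single (G.vertexPt v) 1

end CombGraph
/-! ### Tropical admissible covers -/

/-- A tropical admissible cover between the metric graphs realizing `G` and `D`:
a continuous surjective map with finite fibers which is locally integral affine
(witnessed by the data of the image direction `dirMap` and the absolute value
`slope` of the integral slope along every outgoing direction), such that the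
local degree is well defined at every point, and all Riemann–Hurwitz numbers are
nonnegative. -/
structure TropCover (G D : CombGraph) where
  toFun : G.Space → D.Space
  continuous : Continuous toFun
  surjective : Function.Surjective toFun
  finiteFibers : ∀ y : D.Space, (toFun ⁻¹' {y}).Finite
  dirMap : G.Space → G.E × Bool → D.E × Bool
  slope : G.Space → G.E × Bool → ℕ
  localDeg : G.Space → ℕ
  dirMap_isDir : ∀ x d, G.IsDir x d → D.IsDir (toFun x) (dirMap x d)
  locAffine : ∀ x d, G.IsDir x d → ∃ ε > (0 : ℝ), ∀ u, 0 ≤ u → u ≤ ε →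
      toFun (G.dirPt x d u) = D.dirPt (toFun x) (dirMap x d) ((slope x d : ℝ) * u)
  localDeg_spec : ∀ x d', D.IsDir (toFun x) d' →
      localDeg x = ∑ d ∈ (G.dirSet x).filter (fun d => dirMap x d = d'), slope x d
  rh_nonneg : ∀ x, 0 ≤ (G.valence x : ℤ) - 2 - (localDeg x : ℤ) * ((D.valence (toFun x) : ℤ) - 2)

namespace TropCover

variable {G D : CombGraph} (π : TropCover G D)

/-- The fiber of a point as a finite set. -/
def fiber (y : D.Space) : Finset G.Space := (π.finiteFibers y).toFinset

/-- The pullback `π*[y]` of the divisor `[y]`. -/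
def fiberDiv (y : D.Space) : CombGraph.Div G :=
  ∑ z ∈ π.fiber y, (π.localDeg z : ℤ) • Finsupp.single z 1

/-- The pullback morphism on divisors. -/
def pullback (A : CombGraph.Div D) : CombGraph.Div G :=
  A.sum fun y n => n • π.fiberDiv y

/-- The pushforward morphism on divisors. -/
def pushforward (A : CombGraph.Div G) : CombGraph.Div D :=
  Finsupp.mapDomain π.toFun A

/-- The degree of the cover, computed at the point `y` of the target. -/
def degAt (y : D.Space) : ℕ := ∑ z ∈ π.fiber y, π.localDeg z

/-- The Riemann–Hurwitz number of the cover at a point of the source. -/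
def rhNum (x : G.Space) : ℤ :=
  (G.valence x : ℤ) - 2 - (π.localDeg x : ℤ) * ((D.valence (π.toFun x) : ℤ) - 2)

/-- The (finite) set of points where the ramification divisor may be supported:
the vertices of the source together with the fibers of the vertices of the target
(at every other point the Riemann–Hurwitz number vanishes). -/
def ramSupport : Finset G.Space :=
  Finset.univ.image G.vertexPt ∪
    Finset.univ.biUnion fun v : D.V => π.fiber (D.vertexPt v)

/-- The ramification divisor `R_π = Σ_x r_π(x)·[x]` of the cover. -/
def ramDiv : CombGraph.Div G :=
  ∑ x ∈ π.ramSupport, π.rhNum x • Finsupp.single x 1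

end TropCover

open Filter Topology

/-! ### One-sided slopes of functions of a real variable -/

/-- The function `g` is affine of slope `m` near `t` in the outgoing direction given by `b`
(increasing for `true`, decreasing for `false`). -/
def HasOutSlope (g : ℝ → ℝ) (t : ℝ) (b : Bool) (m : ℤ) : Prop :=
  ∀ᶠ u in 𝓝[≥] (0 : ℝ), g (t + if b then u else -u) = g t + m * u

lemma eventually_nhdsGE_zero_iff {p : ℝ → Prop} :
    (∀ᶠ u in 𝓝[≥] (0 : ℝ), p u) ↔ ∃ ε > (0 : ℝ), ∀ u, 0 ≤ u → u ≤ ε → p u := by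
  constructor
  · intro h
    obtain ⟨ε, hε, h⟩ := (mem_nhdsGE_iff_exists_Icc_subset.1 h : ∃ u ∈ Set.Ioi (0 : ℝ), _)
    exact ⟨ε, hε, fun u h0 h1 => h ⟨h0, h1⟩⟩
  · rintro ⟨ε, hε, h⟩
    filter_upwards [Icc_mem_nhdsGE hε] with u hu using h u hu.1 hu.2

lemma hasOutSlope_true_iff {g : ℝ → ℝ} {t : ℝ} {m : ℤ} :
    HasOutSlope g t true m ↔ ∃ ε > 0, ∀ u, t ≤ u → u ≤ t + ε → g u = g t + m * (u - t) := by
  rw [HasOutSlope, eventually_nhdsGE_zero_iff]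
  refine exists_congr fun ε => and_congr_right fun _ => ⟨fun h u h0 h1 => ?_, fun h u h0 h1 => ?_⟩
  · simpa using h (u - t) (by linarith) (by linarith)
  · simpa using h (t + u) (by linarith) (by linarith)

lemma hasOutSlope_false_iff {g : ℝ → ℝ} {t : ℝ} {m : ℤ} :
    HasOutSlope g t false m ↔ ∃ ε > 0, ∀ u, t - ε ≤ u → u ≤ t → g u = g t + m * (t - u) := by
  rw [HasOutSlope, eventually_nhdsGE_zero_iff]
  refine exists_congr fun ε => and_congr_right fun _ => ⟨fun h u h0 h1 => ?_, fun h u h0 h1 => ?_⟩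
  · simpa using h (t - u) (by linarith) (by linarith)
  · simpa [← sub_eq_add_neg] using h (t - u) (by linarith) (by linarith)

lemma HasOutSlope.derivWithin_Ici {g : ℝ → ℝ} {t : ℝ} {m : ℤ} (h : HasOutSlope g t true m) :
    derivWithin g (Set.Ici t) t = m := by
  obtain ⟨ε, hε, h⟩ := hasOutSlope_true_iff.1 h
  have hd : HasDerivWithinAt (fun u => g t + m * (u - t)) m (Set.Ici t) t := by
    simpa using ((((hasDerivAt_id t).sub_const t).const_mul (m : ℝ)).const_add (g t)).hasDerivWithinAt
  refine (hd.congr_of_eventuallyEq ?_ (by simp)).derivWithin (uniqueDiffWithinAt_Ici t)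
  filter_upwards [Icc_mem_nhdsGE (show t < t + ε by linarith)] with u hu using h u hu.1 hu.2

lemma HasOutSlope.derivWithin_Iic {g : ℝ → ℝ} {t : ℝ} {m : ℤ} (h : HasOutSlope g t false m) :
    derivWithin g (Set.Iic t) t = -m := by
  obtain ⟨ε, hε, h⟩ := hasOutSlope_false_iff.1 h
  have hd : HasDerivWithinAt (fun u => g t + m * (t - u)) (-m) (Set.Iic t) t := by
    simpa using ((((hasDerivAt_id t).const_sub t).const_mul (m : ℝ)).const_add (g t)).hasDerivWithinAt
  refine (hd.congr_of_eventuallyEq ?_ (by simp)).derivWithin (uniqueDiffWithinAt_Iic t)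
  filter_upwards [Icc_mem_nhdsLE (show t - ε < t by linarith)] with u hu using h u hu.1 hu.2

/-- A form of induction on a real interval. -/
lemma real_interval_induction {P : ℝ → Prop} {L : ℝ} (hL : 0 ≤ L) (h0 : P 0)
    (hr : ∀ t, 0 ≤ t → t < L → P t → ∃ ε > 0, ∀ u, t < u → u ≤ t + ε → u ≤ L → P u)
    (hl : ∀ t, 0 < t → t ≤ L → ∃ ε > 0, ∀ s, 0 ≤ s → t - ε ≤ s → s < t → P s → P t) :
    P L := by
  set S := {s : ℝ | 0 ≤ s ∧ s ≤ L ∧ P s} with hS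
  have hne : S.Nonempty := ⟨0, le_rfl, hL, h0⟩
  have hbd : BddAbove S := ⟨L, fun s hs => hs.2.1⟩
  have hcL : sSup S ≤ L := csSup_le hne fun s hs => hs.2.1
  have hc0 : 0 ≤ sSup S := le_csSup hbd ⟨le_rfl, hL, h0⟩
  have hP : P (sSup S) := by
    rcases hc0.eq_or_lt with hc | hc
    · rwa [← hc]
    · obtain ⟨ε, hε, h⟩ := hl _ hc hcL
      obtain ⟨s, hs, hlt⟩ := exists_lt_of_lt_csSup hne (show sSup S - ε < sSup S by linarith)
      rcases (le_csSup hbd hs).eq_or_lt with he | he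
      · exact he ▸ hs.2.2
      · exact h s hs.1 hlt.le he hs.2.2
  rcases hcL.eq_or_lt with hc | hc
  · rwa [← hc]
  · obtain ⟨ε, hε, h⟩ := hr _ hc0 hc hP
    have hm : sSup S < min (sSup S + ε) L := lt_min (by linarith) hc
    have : min (sSup S + ε) L ∈ S :=
      ⟨hc0.trans hm.le, min_le_right _ _, h _ hm (min_le_left _ _) (min_le_right _ _)⟩
    exact absurd (le_csSup hbd this) (not_le.2 hm)

lemma PWIntAffine.zero (g : ℝ → ℝ) : PWIntAffine g 0 :=
  ⟨0, fun _ => 0, fun _ => 0, fun _ => 0, rfl, rfl, by simp, by simp⟩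

lemma PWIntAffine.extend {g : ℝ → ℝ} {a b : ℝ} (h : PWIntAffine g a) (hab : a < b) {m : ℤ} {c : ℝ}
    (hg : ∀ u, a ≤ u → u ≤ b → g u = m * u + c) : PWIntAffine g b := by
  obtain ⟨n, t, k, d, h0, hn, hlt, haff⟩ := h
  refine ⟨n + 1, fun i => if i ≤ n then t i else b, fun i => if i < n then k i else m,
    fun i => if i < n then d i else c, by simpa, by simp, fun i hi => ?_, fun i hi u h1 h2 => ?_⟩
  · rcases (Nat.lt_succ_iff.1 hi).eq_or_lt with rfl | h
    · simpa [hn]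
    · simpa [h.le, Nat.succ_le_of_lt h] using hlt i h
  · rcases (Nat.lt_succ_iff.1 hi).eq_or_lt with rfl | h
    · simp only [le_refl, if_true, hn] at h1
      simp only [Nat.not_succ_le_self, if_false] at h2
      simpa using hg u h1 h2
    · simp only [h.le, if_true] at h1
      simp only [Nat.succ_le_of_lt h, if_true] at h2
      simpa [h] using haff i h u h1 h2

lemma PWIntAffine.of_hasOutSlope {g : ℝ → ℝ} {L : ℝ} (hL : 0 ≤ L)
    (hr : ∀ t, 0 ≤ t → t < L → ∃ m, HasOutSlope g t true m)
    (hl : ∀ t, 0 < t → t ≤ L → ∃ m, HasOutSlope g t false m) : PWIntAffine g L := by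
  refine real_interval_induction hL (PWIntAffine.zero g) (fun t h0 h1 hP => ?_) fun t h0 h1 => ?_
  · obtain ⟨m, hm⟩ := hr t h0 h1
    obtain ⟨ε, hε, h⟩ := hasOutSlope_true_iff.1 hm
    refine ⟨ε, hε, fun u htu hu _ => hP.extend htu (m := m) (c := g t - m * t) fun v h2 h3 => ?_⟩
    rw [h v h2 (h3.trans hu)]; ring
  · obtain ⟨m, hm⟩ := hl t h0 h1
    obtain ⟨ε, hε, h⟩ := hasOutSlope_false_iff.1 hm
    refine ⟨ε, hε, fun s _ hs hst hP => hP.extend hst (m := -m) (c := g t + m * t) fun v h2 h3 => ?_⟩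
    rw [h v (hs.trans h2) h3]; push_cast; ring

lemma PWIntAffine.exists_hasOutSlope_true {g : ℝ → ℝ} {L t : ℝ} (h : PWIntAffine g L)
    (h0 : 0 ≤ t) (h1 : t < L) : ∃ m, HasOutSlope g t true m := by
  obtain ⟨n, s, k, d, hs0, hsn, hlt, haff⟩ := h
  obtain ⟨i, hin, hi1, hi2⟩ : ∃ i < n, s i ≤ t ∧ t < s (i + 1) := by
    by_contra! hc
    have : ∀ i ≤ n, s i ≤ t := fun i => by
      induction i with
      | zero => intro _; rwa [hs0]
      | succ i ih => exact fun hi => hc i hi (ih (by omega))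
    linarith [this n le_rfl]
  refine ⟨k i, hasOutSlope_true_iff.2 ⟨s (i + 1) - t, by linarith, fun u hu1 hu2 => ?_⟩⟩
  rw [haff i hin u (by linarith) (by linarith), haff i hin t hi1 hi2.le]; ring

lemma PWIntAffine.exists_hasOutSlope_false {g : ℝ → ℝ} {L t : ℝ} (h : PWIntAffine g L)
    (h0 : 0 < t) (h1 : t ≤ L) : ∃ m, HasOutSlope g t false m := by
  obtain ⟨n, s, k, d, hs0, hsn, hlt, haff⟩ := h
  obtain ⟨i, hin, hi1, hi2⟩ : ∃ i < n, s i < t ∧ t ≤ s (i + 1) := by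
    by_contra! hc
    have : ∀ i ≤ n, s i < t := fun i => by
      induction i with
      | zero => intro _; rwa [hs0]
      | succ i ih => exact fun hi => hc i hi (ih (by omega))
    linarith [this n le_rfl]
  refine ⟨-k i, hasOutSlope_false_iff.2 ⟨t - s i, by linarith, fun u hu1 hu2 => ?_⟩⟩
  rw [haff i hin u (by linarith) (by linarith), haff i hin t hi1.le hi2]; push_cast; ring

lemma HasOutSlope.unique {g : ℝ → ℝ} {t : ℝ} {b : Bool} {m m' : ℤ} (h : HasOutSlope g t b m)
    (h' : HasOutSlope g t b m') : m = m' := by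
  obtain ⟨ε, hε, h⟩ := eventually_nhdsGE_zero_iff.1 (h.and h')
  obtain ⟨h1, h2⟩ := h ε hε.le le_rfl
  have : (m : ℝ) * ε = m' * ε := by linarith
  exact_mod_cast mul_right_cancel₀ hε.ne' this

lemma hasOutSlope_of_affine {g : ℝ → ℝ} {a b c : ℝ} {m : ℤ}
    (hg : ∀ u, a ≤ u → u ≤ b → g u = m * u + c) :
    (∀ v, a ≤ v → v < b → HasOutSlope g v true m) ∧
      (∀ v, a < v → v ≤ b → HasOutSlope g v false (-m)) := by
  refine ⟨fun v h1 h2 => hasOutSlope_true_iff.2 ⟨b - v, by linarith, fun u h3 h4 => ?_⟩,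
    fun v h1 h2 => hasOutSlope_false_iff.2 ⟨v - a, by linarith, fun u h3 h4 => ?_⟩⟩
  · rw [hg u (by linarith) (by linarith), hg v (by linarith) (by linarith)]; ring
  · rw [hg u (by linarith) (by linarith), hg v (by linarith) (by linarith)]; push_cast; ring

lemma sum_filter_Ioo_eq_add {f : ℝ → ℤ} {S : Finset ℝ} {t u : ℝ} (h0 : 0 ≤ t) (htu : t < u)
    (hf : ∀ x, t < x → x < u → f x = 0) (ht : 0 < t → t ∉ S → f t = 0) :
    ∑ x ∈ S with 0 < x ∧ x < u, f x =
      ∑ x ∈ S with 0 < x ∧ x < t, f x + if 0 < t then f t else 0 := by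
  have key : ∀ x, (if 0 < x ∧ x < u then f x else 0) =
      (if 0 < x ∧ x < t then f x else 0) + if t = x then (if 0 < t then f t else 0) else 0 := by
    intro x
    rcases lt_trichotomy x t with h | rfl | h
    · simp [h, h.trans htu, h.ne']
    · simp [htu]
    · by_cases hu : x < u
      · simp [h.ne, h.not_gt, hf x h hu]
      · simp [h.ne, h.not_gt, hu]
  rw [Finset.sum_filter, Finset.sum_filter, Finset.sum_congr rfl fun x _ => key x,
    Finset.sum_add_distrib, Finset.sum_ite_eq]
  by_cases hS : t ∈ S
  · simp [hS]
  · by_cases hp : 0 < t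
    · simp [hS, ht hp hS]
    · simp [hp]

/-- The slope jumps of a piecewise affine function on an interval telescope. -/
lemma sum_slope_jumps {g : ℝ → ℝ} {L : ℝ} (hL : 0 < L) {r l : ℝ → ℤ}
    (hr : ∀ t, 0 ≤ t → t < L → HasOutSlope g t true (r t))
    (hl : ∀ t, 0 < t → t ≤ L → HasOutSlope g t false (l t))
    {S : Finset ℝ} (hS : ∀ t, 0 < t → t < L → t ∉ S → r t + l t = 0) :
    ∑ t ∈ S with 0 < t ∧ t < L, (r t + l t) + (r 0 + l L) = 0 := by
  have step : ∀ a b c : ℝ, ∀ m : ℤ, 0 ≤ a → b ≤ L → (∀ u, a ≤ u → u ≤ b → g u = m * u + c) →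
      (∀ v, a ≤ v → v < b → r v = m) ∧ (∀ v, a < v → v ≤ b → l v = -m) := by
    intro a b c m ha hb hg
    obtain ⟨h1, h2⟩ := hasOutSlope_of_affine hg
    exact ⟨fun v h3 h4 => (hr v (ha.trans h3) (h4.trans_le hb)).unique (h1 v h3 h4),
      fun v h3 h4 => (hl v (ha.trans_lt h3) (h4.trans hb)).unique (h2 v h3 h4)⟩
  have main : L = 0 ∨ ∑ t ∈ S with 0 < t ∧ t < L, (r t + l t) + (r 0 + l L) = 0 := by
    refine real_interval_induction
      (P := fun b => b = 0 ∨ ∑ t ∈ S with 0 < t ∧ t < b, (r t + l t) + (r 0 + l b) = 0)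
      hL.le (Or.inl rfl) (fun t h0 h1 hP => ?_) fun t h0 h1 => ?_
    · obtain ⟨ε, hε, h⟩ := hasOutSlope_true_iff.1 (hr t h0 h1)
      refine ⟨ε, hε, fun u htu hu huL => Or.inr ?_⟩
      obtain ⟨h2, h3⟩ := step t u (g t - r t * t) (r t) h0 huL fun v h4 h5 => by
        rw [h v h4 (h5.trans hu)]; ring
      rw [sum_filter_Ioo_eq_add h0 htu
        (fun x h4 h5 => by rw [h2 x h4.le h5, h3 x h4 h5.le]; ring) (fun h4 => hS t h4 h1),
        h3 u htu le_rfl]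
      rcases h0.eq_or_lt with rfl | hpos
      · have : ∀ x ∈ S, ¬ (0 < x ∧ x < 0) := fun x _ hx => lt_asymm hx.1 hx.2
        simp [Finset.filter_false_of_mem this]
      · rcases hP with rfl | hP
        · exact absurd hpos (lt_irrefl _)
        · rw [if_pos hpos]; linarith
    · obtain ⟨ε, hε, h⟩ := hasOutSlope_false_iff.1 (hl t h0 h1)
      refine ⟨ε / 2, half_pos hε, fun s hs0 hs hst hP => Or.inr ?_⟩
      obtain ⟨h2, h3⟩ := step (max 0 (t - ε)) t (g t + l t * t) (-l t) (le_max_left _ _) h1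
        fun v h4 h5 => by
          rw [h v ((le_max_right _ _).trans h4) h5]; push_cast; ring
      rw [neg_neg] at h3
      have h6 : max 0 (t - ε) ≤ s := max_le hs0 (by linarith)
      rw [sum_filter_Ioo_eq_add hs0 hst
        (fun x h4 h5 => by rw [h2 x (h6.trans h4.le) h5, h3 x (h6.trans_lt h4) h5.le]; ring)
        (fun h4 => hS s h4 (hst.trans_le h1))]
      rcases hs0.eq_or_lt with rfl | hpos
      · have : ∀ x ∈ S, ¬ (0 < x ∧ x < 0) := fun x _ hx => lt_asymm hx.1 hx.2
        simp [Finset.filter_false_of_mem this, h2 0 h6 hst]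
      · have h7 : max 0 (t - ε) < s := max_lt hpos (by linarith)
        rcases hP with rfl | hP
        · exact absurd hpos (lt_irrefl _)
        · rw [if_pos hpos, h2 s h6 hst, h3 s h7 hst.le]
          rw [h3 s h7 hst.le] at hP
          linarith
  exact main.resolve_left hL.ne'

namespace CombGraph

variable {G : CombGraph}

instance : DiscreteTopology G.V := ⟨rfl⟩
instance : DiscreteTopology G.E := ⟨rfl⟩

/-! ### Points of the realization -/

/-- A normal form for points before gluing: endpoints of edges are replaced by vertices. -/
def normalFormPre : G.PreR → G.V ⊕ (G.E × ℝ)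
  | ⟨Sum.inl v, _⟩ => Sum.inl v
  | ⟨Sum.inr (e, t), _⟩ =>
      if t = 0 then Sum.inl (G.src e) else if t = G.len e then Sum.inl (G.tgt e) else Sum.inr (e, t)

/-- A normal form for points of the realization. -/
def normalForm : G.Space → G.V ⊕ (G.E × ℝ) :=
  Quot.lift normalFormPre (by
    rintro _ _ (e | e)
    · simp [normalFormPre]
    · simp [normalFormPre, (G.len_pos e).ne'])

lemma normalForm_vertexPt (v : G.V) : normalForm (G.vertexPt v) = Sum.inl v := rfl

lemma clamp_of_mem {e : G.E} {t : ℝ} (h0 : 0 ≤ t) (h1 : t ≤ G.len e) : G.clamp e t = t := by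
  simp [clamp, h0, h1]

lemma edgePt_of_mem {e : G.E} {t : ℝ} (h0 : 0 ≤ t) (h1 : t ≤ G.len e) :
    G.edgePt e t = Quot.mk _ ⟨Sum.inr (e, t), h0, h1⟩ := by
  simp only [edgePt, clamp_of_mem h0 h1]
  rfl

lemma edgePt_zero (e : G.E) : G.edgePt e 0 = G.vertexPt (G.src e) := by
  rw [edgePt_of_mem le_rfl (G.len_pos e).le]
  exact (Quot.sound (Glue.srcGlue e)).symm

lemma edgePt_len (e : G.E) : G.edgePt e (G.len e) = G.vertexPt (G.tgt e) := by
  rw [edgePt_of_mem (G.len_pos e).le le_rfl]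
  exact (Quot.sound (Glue.tgtGlue e)).symm

lemma normalForm_edgePt {e : G.E} {t : ℝ} (h0 : 0 < t) (h1 : t < G.len e) :
    normalForm (G.edgePt e t) = Sum.inr (e, t) := by
  rw [edgePt_of_mem h0.le h1.le]
  simp [normalForm, normalFormPre, h0.ne', h1.ne]

lemma vertexPt_injective : Function.Injective G.vertexPt := fun _ _ h =>
  Sum.inl_injective (congrArg normalForm h)

lemma edgePt_inj_of_mem_Ioo {e e' : G.E} {t t' : ℝ} (h0 : 0 < t) (h1 : t < G.len e)
    (h0' : 0 ≤ t') (h1' : t' ≤ G.len e') :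
    G.edgePt e t = G.edgePt e' t' ↔ e = e' ∧ t = t' := by
  refine ⟨fun h => ?_, fun h => by rw [h.1, h.2]⟩
  have h := congrArg normalForm h
  rw [normalForm_edgePt h0 h1] at h
  rcases h0'.eq_or_lt with rfl | h0'
  · simp [edgePt_zero, normalForm_vertexPt] at h
  rcases h1'.eq_or_lt with rfl | h1'
  · simp [edgePt_len, normalForm_vertexPt] at h
  · simpa [normalForm_edgePt h0' h1'] using h

lemma vertexPt_eq_edgePt_iff {v : G.V} {e : G.E} {t : ℝ} (h0 : 0 ≤ t) (h1 : t ≤ G.len e) :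
    G.vertexPt v = G.edgePt e t ↔ (t = 0 ∧ G.src e = v) ∨ (t = G.len e ∧ G.tgt e = v) := by
  have hp := (G.len_pos e).ne
  rcases h0.eq_or_lt with rfl | h0
  · simp [edgePt_zero, vertexPt_injective.eq_iff, hp, eq_comm]
  rcases h1.eq_or_lt with rfl | h1
  · simp [edgePt_len, vertexPt_injective.eq_iff, hp.symm, eq_comm]
  · simp only [h0.ne', h1.ne, false_and, or_self, iff_false]
    intro h
    simpa [normalForm_edgePt h0 h1, normalForm_vertexPt] using congrArg normalForm h

lemma vertexPt_or_edgePt (x : G.Space) : (∃ v, x = G.vertexPt v) ∨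
    ∃ e t, 0 < t ∧ t < G.len e ∧ x = G.edgePt e t := by
  induction x using Quot.ind with | mk p =>
  obtain ⟨v | ⟨e, t⟩, hp⟩ := p
  · exact Or.inl ⟨v, rfl⟩
  · have hp' : 0 ≤ t ∧ t ≤ G.len e := hp
    rw [show Quot.mk G.Glue ⟨Sum.inr (e, t), hp⟩ = G.edgePt e t from
      (edgePt_of_mem hp'.1 hp'.2).symm]
    rcases hp'.1.eq_or_lt with rfl | h0
    · exact Or.inl ⟨_, edgePt_zero e⟩
    rcases hp'.2.eq_or_lt with rfl | h1
    · exact Or.inl ⟨_, edgePt_len e⟩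
    · exact Or.inr ⟨e, t, h0, h1, rfl⟩

/-- A function on the realization is continuous when it is constant on each edge. -/
lemma continuous_of_constant_on_edges {X : Type*} [TopologicalSpace X] {f : G.Space → X}
    (hf : ∀ e t, 0 ≤ t → t ≤ G.len e → f (G.edgePt e t) = f (G.edgePt e 0)) : Continuous f := by
  have hc : Continuous (Sum.elim (fun v => f (G.vertexPt v))
      fun p : G.E × ℝ => f (G.edgePt p.1 0)) :=
    continuous_of_discreteTopology.sumElim
      ((continuous_of_discreteTopology (f := fun e => f (G.edgePt e 0))).comp continuous_fst)
  refine continuous_coinduced_dom.2 ((hc.comp (continuous_subtype_val (p := G.Ok))).congr ?_)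
  rintro ⟨p, hp⟩
  rcases p with v | ⟨e, t⟩
  · rfl
  · have hp' : 0 ≤ t ∧ t ≤ G.len e := hp
    exact ((congrArg f (edgePt_of_mem hp'.1 hp'.2)).symm.trans (hf e t hp'.1 hp'.2)).symm

/-! ### Directions -/

lemma isDir_edgePt_true {e : G.E} {t : ℝ} (h0 : 0 ≤ t) (h1 : t < G.len e) :
    G.IsDir (G.edgePt e t) (e, true) := ⟨t, h0, h1, rfl⟩

lemma isDir_edgePt_false {e : G.E} {t : ℝ} (h0 : 0 < t) (h1 : t ≤ G.len e) :
    G.IsDir (G.edgePt e t) (e, false) := ⟨t, h0, h1, rfl⟩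

lemma isDir_vertexPt_true {v : G.V} {e : G.E} :
    G.IsDir (G.vertexPt v) (e, true) ↔ G.src e = v := by
  constructor
  · rintro ⟨t, h0, h1, h⟩
    rcases (vertexPt_eq_edgePt_iff h0 h1.le).1 h with h | h
    · exact h.2
    · exact absurd h.1 h1.ne
  · rintro rfl
    rw [← edgePt_zero]
    exact isDir_edgePt_true le_rfl (G.len_pos e)

lemma isDir_vertexPt_false {v : G.V} {e : G.E} :
    G.IsDir (G.vertexPt v) (e, false) ↔ G.tgt e = v := by
  constructor
  · rintro ⟨t, h0, h1, h⟩
    rcases (vertexPt_eq_edgePt_iff h0.le h1).1 h with h | h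
    · exact absurd h.1 h0.ne'
    · exact h.2
  · rintro rfl
    rw [← edgePt_len]
    exact isDir_edgePt_false (G.len_pos e) le_rfl

lemma isDir_edgePt_iff {e : G.E} {t : ℝ} (h0 : 0 < t) (h1 : t < G.len e) {d : G.E × Bool} :
    G.IsDir (G.edgePt e t) d ↔ d.1 = e := by
  obtain ⟨e', b⟩ := d
  constructor
  · cases b
    · rintro ⟨s, hs0, hs1, h⟩
      exact ((edgePt_inj_of_mem_Ioo h0 h1 hs0.le hs1).1 h).1.symm
    · rintro ⟨s, hs0, hs1, h⟩
      exact ((edgePt_inj_of_mem_Ioo h0 h1 hs0 hs1.le).1 h).1.symm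
  · rintro rfl
    cases b
    · exact isDir_edgePt_false h0 h1.le
    · exact isDir_edgePt_true h0.le h1

lemma dirCoord_spec {x : G.Space} {d : G.E × Bool} (h : G.IsDir x d) :
    0 ≤ G.dirCoord x d ∧ G.dirCoord x d ≤ G.len d.1 ∧ x = G.edgePt d.1 (G.dirCoord x d) ∧
      (d.2 = true → G.dirCoord x d < G.len d.1) ∧ (d.2 = false → 0 < G.dirCoord x d) := by
  obtain ⟨e, b⟩ := d
  cases b
  · have h' : ∃ t, 0 < t ∧ t ≤ G.len e ∧ x = G.edgePt e t := h
    have hs := h'.choose_spec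
    simp only [dirCoord, Bool.false_eq_true, if_false, dif_pos h']
    exact ⟨hs.1.le, hs.2.1, hs.2.2, by simp, fun _ => hs.1⟩
  · have h' : ∃ t, 0 ≤ t ∧ t < G.len e ∧ x = G.edgePt e t := h
    have hs := h'.choose_spec
    simp only [dirCoord, if_true, dif_pos h']
    exact ⟨hs.1, hs.2.1.le, hs.2.2, fun _ => hs.2.1, by simp⟩

lemma dirCoord_edgePt_true {e : G.E} {t : ℝ} (h0 : 0 ≤ t) (h1 : t < G.len e) :
    G.dirCoord (G.edgePt e t) (e, true) = t := by
  obtain ⟨h2, h3, h4, h5, -⟩ := dirCoord_spec (isDir_edgePt_true h0 h1)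
  rcases h0.eq_or_lt with rfl | h0
  · rw [edgePt_zero] at h2 h3 h4 h5 ⊢
    rcases (vertexPt_eq_edgePt_iff h2 h3).1 h4 with h | h
    · exact h.1
    · exact absurd h.1 (h5 rfl).ne
  · exact ((edgePt_inj_of_mem_Ioo h0 h1 h2 h3).1 h4).2.symm

lemma dirCoord_edgePt_false {e : G.E} {t : ℝ} (h0 : 0 < t) (h1 : t ≤ G.len e) :
    G.dirCoord (G.edgePt e t) (e, false) = t := by
  obtain ⟨h2, h3, h4, -, h5⟩ := dirCoord_spec (isDir_edgePt_false h0 h1)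
  rcases h1.eq_or_lt with rfl | h1
  · rw [edgePt_len] at h2 h3 h4 h5 ⊢
    rcases (vertexPt_eq_edgePt_iff h2 h3).1 h4 with h | h
    · exact absurd h.1 (h5 rfl).ne'
    · exact h.1
  · exact ((edgePt_inj_of_mem_Ioo h0 h1 h2 h3).1 h4).2.symm

/-! ### Orders of rational functions -/

/-- The rational function `f` has outgoing slope `m` at `x` in the direction `d`. -/
def HasSlope (f : RatFn G) (x : G.Space) (d : G.E × Bool) (m : ℤ) : Prop :=
  HasOutSlope (fun t => f.toFun (G.edgePt d.1 t)) (G.dirCoord x d) d.2 m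

lemma exists_hasSlope (f : RatFn G) {x : G.Space} {d : G.E × Bool} (h : G.IsDir x d) :
    ∃ m, HasSlope f x d m := by
  obtain ⟨h0, h1, -, ht, hf⟩ := dirCoord_spec h
  obtain ⟨e, b⟩ := d
  cases b
  · exact (f.piecewise e).exists_hasOutSlope_false (hf rfl) h1
  · exact (f.piecewise e).exists_hasOutSlope_true h0 (ht rfl)

lemma HasSlope.rightSlope_eq {f : RatFn G} {e : G.E} {t : ℝ} {m : ℤ} (h0 : 0 ≤ t)
    (h1 : t < G.len e) (h : HasSlope f (G.edgePt e t) (e, true) m) : G.rightSlope f e t = m := by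
  rw [HasSlope, dirCoord_edgePt_true h0 h1] at h
  exact h.derivWithin_Ici

lemma HasSlope.leftSlope_eq {f : RatFn G} {e : G.E} {t : ℝ} {m : ℤ} (h0 : 0 < t)
    (h1 : t ≤ G.len e) (h : HasSlope f (G.edgePt e t) (e, false) m) : G.leftSlope f e t = -m := by
  rw [HasSlope, dirCoord_edgePt_false h0 h1] at h
  exact h.derivWithin_Iic

lemma ordAt_vertexPt (f : RatFn G) (v : G.V) : G.ordAt f (G.vertexPt v) =
    ∑ e : G.E, ((if G.src e = v then G.rightSlope f e 0 else 0)
      + (if G.tgt e = v then -(G.leftSlope f e (G.len e)) else 0)) := by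
  have h : ∃ w, G.vertexPt v = G.vertexPt w := ⟨v, rfl⟩
  have hc : h.choose = v := (vertexPt_injective h.choose_spec).symm
  rw [ordAt, dif_pos h, hc]

lemma ordAt_edgePt (f : RatFn G) {e : G.E} {t : ℝ} (h0 : 0 < t) (h1 : t < G.len e) :
    G.ordAt f (G.edgePt e t) = G.rightSlope f e t - G.leftSlope f e t := by
  have h : ¬ ∃ v, G.edgePt e t = G.vertexPt v := by
    rintro ⟨v, hv⟩
    rcases (vertexPt_eq_edgePt_iff h0.le h1.le).1 hv.symm with h | h
    · exact h0.ne' h.1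
    · exact h1.ne h.1
  have h2 : ∃ p : G.E × ℝ, 0 < p.2 ∧ p.2 < G.len p.1 ∧ G.edgePt e t = G.edgePt p.1 p.2 :=
    ⟨(e, t), h0, h1, rfl⟩
  obtain ⟨hc0, hc1, hc⟩ := h2.choose_spec
  obtain ⟨he, ht⟩ := (edgePt_inj_of_mem_Ioo h0 h1 hc0.le hc1.le).1 hc
  rw [ordAt, dif_neg h, dif_pos h2, ← he, ← ht]

/-- The order of a rational function is the sum of its outgoing slopes. -/
lemma ordAt_eq_sum_slopes {f : RatFn G} {x : G.Space} {m : G.E × Bool → ℤ}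
    (hm : ∀ d, G.IsDir x d → HasSlope f x d (m d)) :
    G.ordAt f x = ((∑ d ∈ G.dirSet x, m d : ℤ) : ℝ) := by
  rw [dirSet, Finset.sum_filter, Fintype.sum_prod_type]
  simp only [Fintype.sum_bool]
  push_cast
  rcases vertexPt_or_edgePt x with ⟨v, rfl⟩ | ⟨e, t, h0, h1, rfl⟩
  · rw [ordAt_vertexPt]
    refine Finset.sum_congr rfl fun e _ => ?_
    simp only [isDir_vertexPt_true, isDir_vertexPt_false]
    congr 1
    · split_ifs with h
      · have := hm (e, true) (isDir_vertexPt_true.2 h)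
        rw [← h, ← edgePt_zero] at this
        exact this.rightSlope_eq le_rfl (G.len_pos e)
      · rfl
    · split_ifs with h
      · have := hm (e, false) (isDir_vertexPt_false.2 h)
        rw [← h, ← edgePt_len] at this
        rw [this.leftSlope_eq (G.len_pos e) le_rfl, neg_neg]
      · rfl
  · simp only [isDir_edgePt_iff h0 h1]
    rw [ordAt_edgePt f h0 h1, (hm _ (isDir_edgePt_true h0.le h1)).rightSlope_eq h0.le h1,
      (hm _ (isDir_edgePt_false h0 h1.le)).leftSlope_eq h0 h1.le]
    rw [Finset.sum_eq_single e (fun e' _ h => by simp [h]) (by simp)]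
    simp

/-! ### Degrees of divisors -/

lemma degDiv_eq_degree (D : G.Div) : G.degDiv D = Finsupp.degree D := rfl

/-- The degree of a divisor as a sum over vertices and over interior points of edges. -/
lemma degDiv_eq_sum (D : G.Div) : ∃ T : Finset ℝ,
    (∀ e t, 0 < t → t < G.len e → t ∉ T → D (G.edgePt e t) = 0) ∧
    G.degDiv D = ∑ v, D (G.vertexPt v) +
      ∑ e, ∑ t ∈ T with 0 < t ∧ t < G.len e, D (G.edgePt e t) := by
  set T : Finset ℝ := D.support.image fun x => Sum.elim (fun _ => 0) Prod.snd (normalForm x)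
  have hT : ∀ e t, 0 < t → t < G.len e → D (G.edgePt e t) ≠ 0 → t ∈ T := fun e t h0 h1 h =>
    Finset.mem_image.2 ⟨G.edgePt e t, Finsupp.mem_support_iff.2 h, by
      rw [normalForm_edgePt h0 h1]; rfl⟩
  refine ⟨T, fun e t h0 h1 h => by_contra fun hD => h (hT e t h0 h1 hD), ?_⟩
  have hD : ∀ p, D p = ∑ x ∈ D.support, if x = p then D x else 0 := fun p => by
    rw [Finset.sum_ite_eq']
    by_cases h : p ∈ D.support
    · rw [if_pos h]
    · rw [if_neg h, Finsupp.notMem_support_iff.1 h]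
  have hrhs : ∑ v, D (G.vertexPt v) + ∑ e, ∑ t ∈ T with 0 < t ∧ t < G.len e, D (G.edgePt e t) =
      ∑ x ∈ D.support, (∑ v, (if x = G.vertexPt v then D x else 0) +
        ∑ e, ∑ t ∈ T with 0 < t ∧ t < G.len e, if x = G.edgePt e t then D x else 0) := by
    rw [Finset.sum_add_distrib, Finset.sum_comm, Finset.sum_comm (s := D.support)]
    congr 1
    · exact Finset.sum_congr rfl fun v _ => hD _
    · refine Finset.sum_congr rfl fun e _ => ?_
      rw [Finset.sum_comm]
      exact Finset.sum_congr rfl fun t _ => hD _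
  rw [hrhs]
  refine Finset.sum_congr rfl fun x hx => ?_
  rcases vertexPt_or_edgePt x with ⟨v, rfl⟩ | ⟨e, t, h0, h1, rfl⟩
  · have hz : ∀ e, ∑ t ∈ T with 0 < t ∧ t < G.len e,
        (if G.vertexPt v = G.edgePt e t then D (G.vertexPt v) else 0) = 0 := fun e =>
      Finset.sum_eq_zero fun t ht => by
        obtain ⟨-, h0, h1⟩ := Finset.mem_filter.1 ht
        rw [if_neg]
        rw [vertexPt_eq_edgePt_iff h0.le h1.le]
        simp [h0.ne', h1.ne]
    simp only [hz, vertexPt_injective.eq_iff]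
    simp
  · have hv : ∀ v, G.edgePt e t ≠ G.vertexPt v := fun v h => by
      have := (vertexPt_eq_edgePt_iff h0.le h1.le).1 h.symm
      simp [h0.ne', h1.ne] at this
    simp only [hv, if_false, Finset.sum_const_zero, zero_add]
    rw [Finset.sum_eq_single e]
    · rw [Finset.sum_eq_single t]
      · simp
      · intro t' ht' hne
        obtain ⟨-, h0', h1'⟩ := Finset.mem_filter.1 ht'
        rw [if_neg]
        rw [edgePt_inj_of_mem_Ioo h0 h1 h0'.le h1'.le]
        exact fun h => hne h.2.symm
      · exact fun h => absurd (Finset.mem_filter.2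
          ⟨hT e t h0 h1 (Finsupp.mem_support_iff.1 hx), h0, h1⟩) h
    · intro e' _ hne
      refine Finset.sum_eq_zero fun t' ht' => ?_
      obtain ⟨-, h0', h1'⟩ := Finset.mem_filter.1 ht'
      rw [if_neg]
      rw [edgePt_inj_of_mem_Ioo h0 h1 h0'.le h1'.le]
      exact fun h => hne h.1.symm
    · simp

/-- Principal divisors have degree zero. -/
lemma IsPrincipal.degDiv_eq_zero {D : G.Div} {f : RatFn G} (hD : G.IsPrincipal D f) :
    G.degDiv D = 0 := by
  have hr : ∀ e t, ∃ m : ℤ, 0 ≤ t → t < G.len e →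
      HasOutSlope (fun u => f.toFun (G.edgePt e u)) t true m := fun e t => by
    by_cases h : 0 ≤ t ∧ t < G.len e
    · obtain ⟨m, hm⟩ := (f.piecewise e).exists_hasOutSlope_true h.1 h.2
      exact ⟨m, fun _ _ => hm⟩
    · exact ⟨0, fun h0 h1 => absurd ⟨h0, h1⟩ h⟩
  have hl : ∀ e t, ∃ m : ℤ, 0 < t → t ≤ G.len e →
      HasOutSlope (fun u => f.toFun (G.edgePt e u)) t false m := fun e t => by
    by_cases h : 0 < t ∧ t ≤ G.len e
    · obtain ⟨m, hm⟩ := (f.piecewise e).exists_hasOutSlope_false h.1 h.2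
      exact ⟨m, fun _ _ => hm⟩
    · exact ⟨0, fun h0 h1 => absurd ⟨h0, h1⟩ h⟩
  choose r hr using hr
  choose l hl using hl
  obtain ⟨T, hT, hdeg⟩ := degDiv_eq_sum D
  have hE : ∀ e t, 0 < t → t < G.len e → D (G.edgePt e t) = r e t + l e t := fun e t h0 h1 => by
    have h := hD (G.edgePt e t)
    rw [ordAt_edgePt f h0 h1, rightSlope, leftSlope, (hr e t h0.le h1).derivWithin_Ici,
      (hl e t h0 h1.le).derivWithin_Iic, sub_neg_eq_add] at h
    exact_mod_cast h
  have hV : ∀ v, D (G.vertexPt v) = ∑ e, ((if G.src e = v then r e 0 else 0) +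
      if G.tgt e = v then l e (G.len e) else 0) := fun v => by
    have h := hD (G.vertexPt v)
    simp only [ordAt_vertexPt, rightSlope, leftSlope, neg_neg,
      fun e => (hr e 0 le_rfl (G.len_pos e)).derivWithin_Ici,
      fun e => (hl e _ (G.len_pos e) le_rfl).derivWithin_Iic] at h
    exact_mod_cast h
  have hVsum : ∑ v, D (G.vertexPt v) = ∑ e, (r e 0 + l e (G.len e)) := by
    rw [Finset.sum_congr rfl fun v _ => hV v, Finset.sum_comm]
    simp [Finset.sum_add_distrib]
  rw [hdeg, hVsum, ← Finset.sum_add_distrib]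
  refine Finset.sum_eq_zero fun e _ => ?_
  rw [add_comm, ← sum_slope_jumps (G.len_pos e) (hr e) (hl e) (S := T)
    fun t h0 h1 h => by rw [← hE e t h0 h1, hT e t h0 h1 h]]
  congr 1
  refine Finset.sum_congr rfl fun t ht => ?_
  obtain ⟨-, h0, h1⟩ := Finset.mem_filter.1 ht
  exact hE e t h0 h1

lemma LinEquiv.degDiv_eq {D D' : G.Div} (h : G.LinEquiv D D') : G.degDiv D = G.degDiv D' := by
  obtain ⟨f, hf⟩ := h
  have := hf.degDiv_eq_zero
  rw [degDiv_eq_degree, map_sub, sub_eq_zero] at this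
  exact this

/-! ### Tent functions -/

/-- The tent function supported on `[s, t]` with slopes `1` and `-1`. -/
def tent (s t u : ℝ) : ℝ := max 0 (min (u - s) (t - u))

lemma tent_of_le {s t u : ℝ} (h : u ≤ s) : tent s t u = 0 :=
  max_eq_left ((min_le_left _ _).trans (by linarith))

lemma tent_of_ge {s t u : ℝ} (h : t ≤ u) : tent s t u = 0 :=
  max_eq_left ((min_le_right _ _).trans (by linarith))

lemma tent_of_left {s t u : ℝ} (h : s ≤ u) (h' : u ≤ (s + t) / 2) : tent s t u = u - s := by
  rw [tent, min_eq_left (by linarith), max_eq_right (by linarith)]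

lemma tent_of_right {s t u : ℝ} (h : (s + t) / 2 ≤ u) (h' : u ≤ t) : tent s t u = t - u := by
  rw [tent, min_eq_right (by linarith), max_eq_right (by linarith)]

lemma continuous_tent (s t : ℝ) : Continuous (tent s t) := by
  unfold tent; fun_prop

/-- The right-hand slope of a tent function. -/
def tentRight (s t u : ℝ) : ℤ :=
  if u < s then 0 else if u < (s + t) / 2 then 1 else if u < t then -1 else 0

/-- The outgoing left-hand slope of a tent function. -/
def tentLeft (s t u : ℝ) : ℤ :=
  if u ≤ s then 0 else if u ≤ (s + t) / 2 then -1 else if u ≤ t then 1 else 0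

lemma hasOutSlope_tentRight (s t u : ℝ) :
    HasOutSlope (tent s t) u true (tentRight s t u) := by
  rw [hasOutSlope_true_iff, tentRight]
  split_ifs with h1 h2 h3
  · refine ⟨s - u, by linarith, fun v h4 h5 => ?_⟩
    rw [tent_of_le (by linarith), tent_of_le h1.le]; simp
  · refine ⟨(s + t) / 2 - u, by linarith, fun v h4 h5 => ?_⟩
    rw [tent_of_left (by linarith) (by linarith), tent_of_left (by linarith) h2.le]; simp
  · refine ⟨t - u, by linarith, fun v h4 h5 => ?_⟩
    rw [tent_of_right (by linarith) (by linarith), tent_of_right (by linarith) h3.le]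
    push_cast; ring
  · refine ⟨1, one_pos, fun v h4 h5 => ?_⟩
    rw [tent_of_ge (by linarith), tent_of_ge (by linarith)]; simp

lemma hasOutSlope_tentLeft (s t u : ℝ) :
    HasOutSlope (tent s t) u false (tentLeft s t u) := by
  rw [hasOutSlope_false_iff, tentLeft]
  split_ifs with h1 h2 h3
  · refine ⟨1, one_pos, fun v h4 h5 => ?_⟩
    rw [tent_of_le (by linarith), tent_of_le h1]; simp
  · refine ⟨u - s, by linarith, fun v h4 h5 => ?_⟩
    rw [tent_of_left (by linarith) (by linarith), tent_of_left (by linarith) h2]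
    push_cast; ring
  · refine ⟨u - (s + t) / 2, by linarith, fun v h4 h5 => ?_⟩
    rw [tent_of_right (by linarith) (by linarith), tent_of_right (by linarith) h3]
    push_cast; ring
  · refine ⟨u - t, by linarith, fun v h4 h5 => ?_⟩
    rw [tent_of_ge (by linarith), tent_of_ge (by linarith)]; simp

lemma tentRight_add_tentLeft {s t : ℝ} (hst : s < t) (u : ℝ) :
    tentRight s t u + tentLeft s t u = (if s = u then 1 else 0) + (if t = u then 1 else 0)
      - 2 * (if (s + t) / 2 = u then 1 else 0) := by
  have h1 : s < (s + t) / 2 := by linarith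
  have h2 : (s + t) / 2 < t := by linarith
  unfold tentRight tentLeft
  generalize (s + t) / 2 = m at *
  grind

/-- The tent function on an edge, before gluing. -/
def tentPre (e : G.E) (s t : ℝ) : G.PreR → ℝ
  | ⟨Sum.inl _, _⟩ => 0
  | ⟨Sum.inr (e', u), _⟩ => if e' = e then tent s t u else 0

/-- The tent function on an edge of a metric graph. -/
def tentFun (e : G.E) {s t : ℝ} (hs : 0 ≤ s) (ht : t ≤ G.len e) : G.Space → ℝ :=
  Quot.lift (tentPre e s t) (by
    rintro _ _ (e' | e')
    · simp [tentPre, tent_of_le hs]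
    · simp only [tentPre]
      split_ifs with h
      · rw [h, tent_of_ge ht]
      · rfl)

lemma tentFun_edgePt {e : G.E} {s t : ℝ} (hs : 0 ≤ s) (ht : t ≤ G.len e) (e' : G.E) (u : ℝ) :
    tentFun e hs ht (G.edgePt e' u) = if e' = e then tent s t u else 0 := by
  change (if e' = e then tent s t (G.clamp e' u) else 0) = _
  split_ifs with h
  · subst h
    rcases le_total u 0 with h0 | h0
    · rw [tent_of_le (h0.trans hs), tent_of_le]
      simp [clamp, h0, hs]
    rcases le_total u (G.len e') with h1 | h1
    · rw [clamp_of_mem h0 h1]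
    · rw [tent_of_ge (ht.trans h1), tent_of_ge]
      simp [clamp, h1, ht]
  · rfl

lemma continuous_tentFun (e : G.E) {s t : ℝ} (hs : 0 ≤ s) (ht : t ≤ G.len e) :
    Continuous (tentFun e hs ht) := by
  have hc : Continuous (Sum.elim (fun _ => 0)
      fun p : G.E × ℝ => (if p.1 = e then 1 else 0) * tent s t p.2) :=
    (continuous_of_discreteTopology (α := G.V)).sumElim
      (((continuous_of_discreteTopology (f := fun e' => if e' = e then (1 : ℝ) else 0)).comp
        continuous_fst).mul ((continuous_tent s t).comp continuous_snd))
  refine continuous_coinduced_dom.2 ((hc.comp (continuous_subtype_val (p := G.Ok))).congr ?_)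
  rintro ⟨v | ⟨e', u⟩, hp⟩
  · rfl
  · change (if e' = e then 1 else 0) * tent s t u = if e' = e then tent s t u else 0
    simp

lemma hasOutSlope_tentFun {e : G.E} {s t : ℝ} (hs : 0 ≤ s) (ht : t ≤ G.len e)
    (e' : G.E) (u : ℝ) :
    HasOutSlope (fun u => tentFun e hs ht (G.edgePt e' u)) u true
        (if e' = e then tentRight s t u else 0) ∧
      HasOutSlope (fun u => tentFun e hs ht (G.edgePt e' u)) u false
        (if e' = e then tentLeft s t u else 0) := by
  simp only [tentFun_edgePt]
  split_ifs with h
  · exact ⟨hasOutSlope_tentRight s t u, hasOutSlope_tentLeft s t u⟩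
  · simp [HasOutSlope]

/-- The tent function on an edge as a rational function. -/
def tentRatFn (e : G.E) {s t : ℝ} (hs : 0 ≤ s) (ht : t ≤ G.len e) : RatFn G where
  toFun := tentFun e hs ht
  continuous := continuous_tentFun e hs ht
  piecewise e' := .of_hasOutSlope (G.len_pos e').le
    (fun u _ _ => ⟨_, (hasOutSlope_tentFun hs ht e' u).1⟩)
    (fun u _ _ => ⟨_, (hasOutSlope_tentFun hs ht e' u).2⟩)

lemma linEquiv_midpoint (e : G.E) {s t : ℝ} (hs : 0 ≤ s) (hst : s < t) (ht : t ≤ G.len e) :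
    G.LinEquiv (Finsupp.single (G.edgePt e s) 1 + Finsupp.single (G.edgePt e t) 1)
      ((2 : ℤ) • Finsupp.single (G.edgePt e ((s + t) / 2)) 1) := by
  refine ⟨tentRatFn e hs ht, fun x => ?_⟩
  have hR : ∀ e' u, G.rightSlope (tentRatFn e hs ht) e' u =
      ((if e' = e then tentRight s t u else 0 : ℤ) : ℝ) := fun e' u =>
    (hasOutSlope_tentFun hs ht e' u).1.derivWithin_Ici
  have hL : ∀ e' u, G.leftSlope (tentRatFn e hs ht) e' u =
      -((if e' = e then tentLeft s t u else 0 : ℤ) : ℝ) := fun e' u =>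
    (hasOutSlope_tentFun hs ht e' u).2.derivWithin_Iic
  have hm0 : 0 < (s + t) / 2 := by linarith
  have hm1 : (s + t) / 2 < G.len e := by linarith
  rcases vertexPt_or_edgePt x with ⟨v, rfl⟩ | ⟨e', u, h0, h1, rfl⟩
  · simp only [ordAt_vertexPt, hR, hL, neg_neg]
    rw [Finset.sum_eq_single e (fun e' _ h => by simp [h]) (by simp)]
    have e1 : G.vertexPt v = G.edgePt e s ↔ s = 0 ∧ G.src e = v := by
      rw [vertexPt_eq_edgePt_iff hs (hst.le.trans ht)]
      simp [(hst.trans_le ht).ne]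
    have e2 : G.vertexPt v = G.edgePt e t ↔ t = G.len e ∧ G.tgt e = v := by
      rw [vertexPt_eq_edgePt_iff (hs.trans hst.le) ht]
      simp [(hs.trans_lt hst).ne']
    have e3 : G.vertexPt v ≠ G.edgePt e ((s + t) / 2) := fun h => by
      simpa [hm0.ne', hm1.ne] using (vertexPt_eq_edgePt_iff hm0.le hm1.le).1 h
    have r0 : tentRight s t 0 = if s = 0 then 1 else 0 := by
      rcases hs.eq_or_lt with h | h
      · simp [tentRight, ← h, h ▸ hst]
      · simp [tentRight, h, h.ne']
    have l0 : tentLeft s t (G.len e) = if t = G.len e then 1 else 0 := by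
      rcases ht.eq_or_lt with h | h
      · simp [tentLeft, ← h, hst.not_ge, show ¬ t ≤ (s + t) / 2 by linarith]
      · simp [tentLeft, h.ne, h.not_ge, (hst.trans h).not_ge, hm1.not_ge]
    simp only [Finsupp.sub_apply, Finsupp.add_apply, Finsupp.smul_apply, Finsupp.single_apply,
      eq_comm (b := G.vertexPt v), e1, e2, e3, r0, l0]
    by_cases h1 : G.src e = v <;> by_cases h2 : G.tgt e = v <;> simp [h1, h2]
  · simp only [ordAt_edgePt _ h0 h1, hR, hL, sub_neg_eq_add]
    simp only [Finsupp.sub_apply, Finsupp.add_apply, Finsupp.smul_apply, Finsupp.single_apply,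
      eq_comm (b := G.edgePt e' u), edgePt_inj_of_mem_Ioo h0 h1 hs (hst.le.trans ht),
      edgePt_inj_of_mem_Ioo h0 h1 (hs.trans hst.le) ht, edgePt_inj_of_mem_Ioo h0 h1 hm0.le hm1.le]
    by_cases h : e' = e
    · have := tentRight_add_tentLeft hst u
      simp only [h, if_true, true_and, smul_eq_mul, eq_comm (a := u)]
      exact_mod_cast this.symm
    · simp [h]

end CombGraph

/-- An integer-valued midpoint-affine function on an interval is constant. -/
lemma eq_of_midpoint_affine {D : ℝ → ℤ} {L : ℝ}
    (hD : ∀ s t, 0 ≤ s → s < t → t ≤ L → D s + D t = 2 * D ((s + t) / 2)) {t : ℝ}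
    (h0 : 0 ≤ t) (h1 : t ≤ L) : D t = D 0 := by
  have key : ∀ k : ℕ, ∀ t, 0 ≤ t → t ≤ L → (2 : ℤ) ^ k ∣ D t - D 0 := by
    intro k
    induction k with
    | zero => simp
    | succ k ih =>
      intro t h0 h1
      rcases h0.eq_or_lt with rfl | h0
      · simp
      · have := hD 0 t le_rfl h0 h1
        rw [zero_add] at this
        rw [show D t - D 0 = (D (t / 2) - D 0) * 2 by linarith, pow_succ]
        exact mul_dvd_mul_right (ih (t / 2) (by linarith) (by linarith)) 2
  have h := key (D t - D 0).natAbs t h0 h1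
  refine sub_eq_zero.1 (Int.eq_zero_of_dvd_of_natAbs_lt_natAbs h ?_)
  rw [Int.natAbs_pow]
  exact Nat.lt_two_pow_self

namespace TropCover

variable {G D : CombGraph} (π : TropCover G D)

lemma fiberDiv_apply (y : D.Space) (x : G.Space) :
    π.fiberDiv y x = if π.toFun x = y then (π.localDeg x : ℤ) else 0 := by
  simp [fiberDiv, Finsupp.finsetSum_apply, Finsupp.single_apply, fiber]

lemma pullback_apply (A : D.Div) (x : G.Space) :
    π.pullback A x = π.localDeg x * A (π.toFun x) := by
  rw [pullback, Finsupp.sum, Finsupp.finsetSum_apply]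
  simp only [Finsupp.smul_apply, fiberDiv_apply, smul_eq_mul, mul_ite, mul_zero]
  rw [Finset.sum_ite_eq]
  split_ifs with h
  · exact mul_comm _ _
  · rw [Finsupp.notMem_support_iff.1 h, mul_zero]

lemma effective_pullback {A : D.Div} (hA : D.Effective A) : G.Effective (π.pullback A) := fun x => by
  rw [pullback_apply]
  exact mul_nonneg (Int.natCast_nonneg _) (hA _)

lemma degDiv_fiberDiv (y : D.Space) : G.degDiv (π.fiberDiv y) = π.degAt y := by
  rw [CombGraph.degDiv_eq_degree, fiberDiv, degAt, map_sum]
  simp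

lemma degDiv_pullback_eq_sum (A : D.Div) :
    G.degDiv (π.pullback A) = A.sum fun y n => n * (π.degAt y : ℤ) := by
  rw [pullback, CombGraph.degDiv_eq_degree, Finsupp.sum, map_sum]
  refine Finset.sum_congr rfl fun y _ => ?_
  rw [map_zsmul, ← CombGraph.degDiv_eq_degree, degDiv_fiberDiv, smul_eq_mul]

/-- Outgoing slopes of the composite of a rational function with a cover. -/
lemma hasSlope_comp {f : RatFn D} {x : G.Space} {d : G.E × Bool} {m : ℤ} (hd : G.IsDir x d)
    (h : CombGraph.HasSlope f (π.toFun x) (π.dirMap x d) m) :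
    HasOutSlope (fun t => f.toFun (π.toFun (G.edgePt d.1 t))) (G.dirCoord x d) d.2
      (π.slope x d * m) := by
  have hx := (CombGraph.dirCoord_spec hd).2.2.1
  have hy := (CombGraph.dirCoord_spec (π.dirMap_isDir x d hd)).2.2.1
  have haff := eventually_nhdsGE_zero_iff.2 (π.locAffine x d hd)
  have hlim : Tendsto (fun u : ℝ => (π.slope x d : ℝ) * u) (𝓝[≥] 0) (𝓝[≥] 0) := by
    refine tendsto_nhdsWithin_iff.2 ⟨?_, ?_⟩
    · exact ((continuous_const.mul continuous_id).tendsto' 0 0 (by simp)).mono_left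
        nhdsWithin_le_nhds
    · filter_upwards [self_mem_nhdsWithin] with u hu
      exact mul_nonneg (Nat.cast_nonneg _) (Set.mem_Ici.1 hu)
  rw [CombGraph.HasSlope, HasOutSlope, ← hy] at h
  rw [HasOutSlope, ← hx]
  filter_upwards [haff, hlim.eventually h] with u h1 h2
  rw [CombGraph.dirPt, CombGraph.dirPt] at h1
  rw [h1, h2]
  push_cast; ring

/-- The pullback of a rational function along a cover. -/
def pullbackRatFn (f : RatFn D) : RatFn G where
  toFun := f.toFun ∘ π.toFun
  continuous := f.continuous.comp π.continuous
  piecewise e := by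
    refine .of_hasOutSlope (G.len_pos e).le (fun t h0 h1 => ?_) (fun t h0 h1 => ?_)
    · have hd := CombGraph.isDir_edgePt_true h0 h1
      obtain ⟨m, hm⟩ := CombGraph.exists_hasSlope f (π.dirMap_isDir _ _ hd)
      have := π.hasSlope_comp hd hm
      rw [CombGraph.dirCoord_edgePt_true h0 h1] at this
      exact ⟨_, this⟩
    · have hd := CombGraph.isDir_edgePt_false h0 h1
      obtain ⟨m, hm⟩ := CombGraph.exists_hasSlope f (π.dirMap_isDir _ _ hd)
      have := π.hasSlope_comp hd hm
      rw [CombGraph.dirCoord_edgePt_false h0 h1] at this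
      exact ⟨_, this⟩

lemma ordAt_pullbackRatFn (f : RatFn D) (x : G.Space) :
    G.ordAt (π.pullbackRatFn f) x = π.localDeg x * D.ordAt f (π.toFun x) := by
  have hm : ∀ d', ∃ m, D.IsDir (π.toFun x) d' → CombGraph.HasSlope f (π.toFun x) d' m := fun d' => by
    by_cases h : D.IsDir (π.toFun x) d'
    · exact (CombGraph.exists_hasSlope f h).imp fun m hm _ => hm
    · exact ⟨0, fun h' => absurd h' h⟩
  choose m hm using hm
  rw [CombGraph.ordAt_eq_sum_slopes (m := m) hm,
    CombGraph.ordAt_eq_sum_slopes (f := π.pullbackRatFn f) (m := fun d => π.slope x d * m (π.dirMap x d))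
      fun d hd => π.hasSlope_comp hd (hm _ (π.dirMap_isDir x d hd)),
    ← Finset.sum_fiberwise_of_maps_to (s := G.dirSet x) (t := D.dirSet (π.toFun x))
      (g := π.dirMap x) fun d hd => by
        simpa [CombGraph.dirSet] using π.dirMap_isDir x d (by simpa [CombGraph.dirSet] using hd)]
  rw [← Int.cast_natCast, ← Int.cast_mul, Finset.mul_sum]
  congr 1
  refine Finset.sum_congr rfl fun d' hd' => ?_
  rw [π.localDeg_spec x d' (by simpa [CombGraph.dirSet] using hd'), Nat.cast_sum, Finset.sum_mul]
  exact Finset.sum_congr rfl fun d hd => by rw [(Finset.mem_filter.1 hd).2]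

lemma linEquiv_pullback {A B : D.Div} (h : D.LinEquiv A B) :
    G.LinEquiv (π.pullback A) (π.pullback B) := by
  obtain ⟨f, hf⟩ := h
  refine ⟨π.pullbackRatFn f, fun x => ?_⟩
  rw [ordAt_pullbackRatFn, ← hf (π.toFun x), Finsupp.sub_apply, Finsupp.sub_apply, pullback_apply,
    pullback_apply]
  push_cast; ring

/-- The weighted number of points in the fibers is constant along edges. -/
lemma degAt_edgePt (e : D.E) {t : ℝ} (h0 : 0 ≤ t) (h1 : t ≤ D.len e) :
    π.degAt (D.edgePt e t) = π.degAt (D.edgePt e 0) := by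
  have h := eq_of_midpoint_affine (D := fun t => (π.degAt (D.edgePt e t) : ℤ)) (L := D.len e)
    (fun s t hs hst ht => by
      have h := (π.linEquiv_pullback (CombGraph.linEquiv_midpoint e hs hst ht)).degDiv_eq
      rw [degDiv_pullback_eq_sum, degDiv_pullback_eq_sum,
        Finsupp.sum_add_index' (by simp) (by intros; ring), Finsupp.smul_single] at h
      simpa using h) h0 h1
  exact_mod_cast h

/-- The degree of a cover of a connected graph does not depend on the point of the target. -/
lemma degAt_eq [ConnectedSpace D.Space] (y z : D.Space) : π.degAt y = π.degAt z :=
  PreconnectedSpace.constant inferInstance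
    (CombGraph.continuous_of_constant_on_edges fun e _ h0 h1 => π.degAt_edgePt e h0 h1)

lemma degDiv_pullback [ConnectedSpace D.Space] (A : D.Div) (y : D.Space) :
    G.degDiv (π.pullback A) = (π.degAt y : ℤ) * D.degDiv A := by
  rw [degDiv_pullback_eq_sum, CombGraph.degDiv, Finsupp.sum, Finsupp.sum, Finset.mul_sum]
  exact Finset.sum_congr rfl fun z _ => by rw [π.degAt_eq z y, mul_comm]

end TropCover

/-- the pullback morphism of a tropical admissible cover maps effective
divisors to effective divisors, preserves linear equivalence, and multiplies degrees
by `deg(π)` (computed as the weighted fiber sum over any point `y` of the target). -/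
theorem pullback_properties (Γ Δ : CombGraph)
    (hΓc : CompactSpace Γ.Space) (hΓ : ConnectedSpace Γ.Space)
    (hΔc : CompactSpace Δ.Space) (hΔ : ConnectedSpace Δ.Space)
    (π : TropCover Γ Δ) :
    (∀ A : Δ.Div, Δ.Effective A → Γ.Effective (π.pullback A)) ∧
    (∀ A B : Δ.Div, Δ.LinEquiv A B → Γ.LinEquiv (π.pullback A) (π.pullback B)) ∧
    (∀ (A : Δ.Div) (y : Δ.Space), Γ.degDiv (π.pullback A) = (π.degAt y : ℤ) * Δ.degDiv A) := by
  exact ⟨fun _ hA => π.effective_pullback hA, fun _ _ h => π.linEquiv_pullback h,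
    fun A y => π.degDiv_pullback A y⟩
end
end
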